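/- For all complex numbers z, z', every Young diagram μ with |μ| = m, and every Young diagram λ with |λ| = n, one has ∑_{ν : ν ↘ λ} (z)_{ν/λ} (z')_{ν/λ} · (dim ν / ((n+1) · dim λ)) · FS_μ(ν) = ∑_{μ• : μ• ↗ μ} (z)_{μ/μ•} (z')_{μ/μ•} · FS_{μ•}(λ) + (n + zz' + m) · FS_μ(λ). -/

import Mathlib

/-- `μ ↗ ν` : the Young diagram `ν` is obtained from `μ` by adding one box. -/
def YoungDiagram.Covers (μ ν : YoungDiagram) : Prop :=
  μ ≤ ν ∧ ν.card = μ.card + 1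

/-- `dim(μ,λ)`: the number of saturated chains `μ = ν₀ ↗ ν₁ ↗ … ↗ ν_{|λ|-|μ|} = λ`
(the number of standard Young tableaux of skew shape `λ/μ`); it vanishes when `μ ⊄ λ`. -/
noncomputable def YoungDiagram.skewDim (μ l : YoungDiagram) : ℕ :=
  Nat.card {f : Fin (l.card - μ.card + 1) → YoungDiagram //
    f 0 = μ ∧ f (Fin.last _) = l ∧
    ∀ i : Fin (l.card - μ.card), YoungDiagram.Covers (f i.castSucc) (f i.succ)}

/-- `dim λ`: the number of standard Young tableaux of shape `λ`. -/
noncomputable def YoungDiagram.dim (l : YoungDiagram) : ℕ :=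
  YoungDiagram.skewDim ⊥ l

/-- The value `FS_μ(λ)` of the Frobenius–Schur function (as a complex number):
`FS_μ(λ) = n(n-1)⋯(n-m+1) · dim(μ,λ)/dim λ` where `n = |λ|`, `m = |μ|`. -/
noncomputable def YoungDiagram.FS (μ l : YoungDiagram) : ℂ :=
  (∏ i ∈ Finset.range μ.card, ((l.card : ℂ) - (i : ℂ))) * (μ.skewDim l : ℂ) / (l.dim : ℂ)

/-- `(w)_{λ/μ} = ∏_{(i,j) ∈ λ∖μ} (w + j - i)`, the product of `w` shifted by the contents
of the boxes of the skew diagram `λ/μ`. -/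
noncomputable def YoungDiagram.poch (w : ℂ) (μ l : YoungDiagram) : ℂ :=
  ∏ b ∈ l.cells \ μ.cells, (w + (b.2 : ℂ) - (b.1 : ℂ))

namespace YoungDiagram
open Finset

theorem UO_lt_card_left (l : YoungDiagram) {i j : ℕ} (h : (i, j) ∈ l) : i < l.card := by
  have : (Finset.range (i+1)).card ≤ l.card := by
    refine Finset.card_le_card_of_injOn (fun k => (k, j)) ?_ ?_
    · intro k hk
      have hk : k < i + 1 := by simpa using hk
      exact l.up_left_mem (by omega) le_rfl h
    · intro a _ b _ hab
      simpa using hab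
  simpa using this

theorem UO_lt_card_right (l : YoungDiagram) {i j : ℕ} (h : (i, j) ∈ l) : j < l.card := by
  have : (Finset.range (j+1)).card ≤ l.card := by
    refine Finset.card_le_card_of_injOn (fun k => (i, k)) ?_ ?_
    · intro k hk
      have hk : k < j + 1 := by simpa using hk
      exact l.up_left_mem le_rfl (by omega) h
    · intro a _ b _ hab
      simpa using hab
  simpa using this

theorem UO_ext {a b : YoungDiagram} (h : a.cells = b.cells) : a = b := YoungDiagram.ext h

theorem UO_fin (n : ℕ) : {l : YoungDiagram | l.card = n}.Finite := by
  refine Set.Finite.of_finite_image (f := YoungDiagram.cells) ?_ ?_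
  · refine Set.Finite.subset (((range n) ×ˢ (range n)).powerset.finite_toSet) ?_
    rintro _ ⟨l, hl, rfl⟩
    have hl : l.card = n := hl
    simp only [coe_powerset, Set.mem_preimage, Set.mem_powerset_iff, coe_subset]
    rintro ⟨i, j⟩ hb
    have := l.UO_lt_card_left hb
    have := l.UO_lt_card_right hb
    simp; omega
  · intro a _ b _ hab
    exact UO_ext hab

noncomputable def UO_Y (n : ℕ) : Finset YoungDiagram := (UO_fin n).toFinset

theorem UO_mem_Y {n : ℕ} {l : YoungDiagram} : l ∈ UO_Y n ↔ l.card = n := by simp [UO_Y]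

open Classical in
noncomputable def UO_up (l : YoungDiagram) : Finset YoungDiagram :=
  (UO_Y (l.card + 1)).filter (fun ν => Covers l ν)

open Classical in
noncomputable def UO_down (l : YoungDiagram) : Finset YoungDiagram :=
  (UO_Y (l.card - 1)).filter (fun κ => Covers κ l)

theorem UO_mem_up {l ν : YoungDiagram} : ν ∈ UO_up l ↔ Covers l ν := by
  simp only [UO_up, mem_filter, UO_mem_Y, and_iff_right_iff_imp]
  exact fun h => h.2

theorem UO_mem_down {l κ : YoungDiagram} : κ ∈ UO_down l ↔ Covers κ l := by
  simp only [UO_down, mem_filter, UO_mem_Y, and_iff_right_iff_imp]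
  intro h; have := h.2; omega

/-- chains -/
abbrev UO_chain (μ l : YoungDiagram) (k : ℕ) : Type :=
  {f : Fin (k + 1) → YoungDiagram //
    f 0 = μ ∧ f (Fin.last _) = l ∧
    ∀ i : Fin k, YoungDiagram.Covers (f i.castSucc) (f i.succ)}

theorem UO_sigma_ext (μ l : YoungDiagram) (k : ℕ)
    (x y : Σ κ : {κ // κ ∈ UO_down l}, UO_chain μ κ.1 k) (h : x.2.1 = y.2.1) : x = y := by
  obtain ⟨⟨κ, hκ⟩, ⟨f, h0, h1, h2⟩⟩ := x
  obtain ⟨⟨κ', hκ'⟩, ⟨f', h0', h1', h2'⟩⟩ := y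
  dsimp only at h h1 h1'
  subst h
  subst h1
  subst h1'
  rfl

def UO_chainEquiv (μ l : YoungDiagram) (k : ℕ) :
    UO_chain μ l (k+1) ≃ Σ κ : {κ // κ ∈ UO_down l}, UO_chain μ κ.1 k where
  toFun f := ⟨⟨f.1 (Fin.last k).castSucc, by
      have h := f.2.2.2 (Fin.last k)
      rw [Fin.succ_last, f.2.2.1] at h
      exact UO_mem_down.2 h⟩,
    ⟨fun i => f.1 i.castSucc, f.2.1, rfl, fun i => f.2.2.2 i.castSucc⟩⟩
  invFun x := ⟨Fin.snoc (α := fun _ => YoungDiagram) x.2.1 l, by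
      have := Fin.snoc_castSucc (α := fun _ => YoungDiagram) l x.2.1 0
      exact this.trans x.2.2.1, by simp, by
      intro i
      refine Fin.lastCases ?_ (fun i => ?_) i
      · rw [Fin.snoc_castSucc, Fin.succ_last, Fin.snoc_last, x.2.2.2.1]
        exact UO_mem_down.1 x.1.2
      · rw [Fin.snoc_castSucc, Fin.succ_castSucc, Fin.snoc_castSucc]
        exact x.2.2.2.2 i⟩
  left_inv f := by
    apply Subtype.ext
    funext i
    refine Fin.lastCases ?_ (fun i => ?_) i
    · simp [f.2.2.1]
    · simp
  right_inv x := by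
    apply UO_sigma_ext
    funext i
    exact Fin.snoc_castSucc (α := fun _ => YoungDiagram) l x.2.1 i

theorem UO_chain_zero (μ l : YoungDiagram) [Decidable (μ = l)] :
    Nat.card (UO_chain μ l 0) = if μ = l then 1 else 0 := by
  split_ifs with h
  · subst h
    rw [Nat.card_eq_one_iff_unique]
    refine ⟨⟨fun a b => ?_⟩, ⟨⟨fun _ => μ, rfl, rfl, fun i => i.elim0⟩⟩⟩
    apply Subtype.ext
    funext i
    have : i = 0 := Fin.fin_one_eq_zero i
    rw [this, a.2.1, b.2.1]
  · rw [Nat.card_eq_zero]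
    left
    refine ⟨fun a => h ?_⟩
    exact a.2.1.symm.trans a.2.2.1

theorem UO_chain_finite (μ : YoungDiagram) (k : ℕ) : ∀ l, Finite (UO_chain μ l k) := by
  induction k with
  | zero =>
    intro l
    refine @Finite.of_subsingleton _ ⟨fun a b => ?_⟩
    apply Subtype.ext
    funext i
    have : i = 0 := Fin.fin_one_eq_zero i
    rw [this, a.2.1, b.2.1]
  | succ k ih =>
    intro l
    have := fun κ : {κ // κ ∈ UO_down l} => ih κ.1
    exact Finite.of_equiv _ (UO_chainEquiv μ l k).symm

theorem UO_chain_succ (μ l : YoungDiagram) (k : ℕ) :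
    Nat.card (UO_chain μ l (k+1)) = ∑ κ ∈ UO_down l, Nat.card (UO_chain μ κ k) := by
  have := fun κ : {κ // κ ∈ UO_down l} => UO_chain_finite μ k κ.1
  rw [Nat.card_congr (UO_chainEquiv μ l k), Nat.card_sigma]
  exact Finset.sum_coe_sort (UO_down l) (fun κ => Nat.card (UO_chain μ κ k))

theorem UO_skewDim_chain (μ l : YoungDiagram) :
    skewDim μ l = Nat.card (UO_chain μ l (l.card - μ.card)) := rfl

theorem UO_skewDim_small {μ l : YoungDiagram} (h : l.card ≤ μ.card) [Decidable (μ = l)] :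
    skewDim μ l = if μ = l then 1 else 0 := by
  rw [UO_skewDim_chain, Nat.sub_eq_zero_of_le h, UO_chain_zero]

theorem UO_skewDim_rec (μ l : YoungDiagram) [Decidable (μ = l)] :
    skewDim μ l = (if μ = l then 1 else 0) + ∑ κ ∈ UO_down l, skewDim μ κ := by
  classical
  rcases Nat.lt_or_ge μ.card l.card with h | h
  · have hne : μ ≠ l := by rintro rfl; omega
    rw [if_neg hne, zero_add, UO_skewDim_chain]
    obtain ⟨k, hk⟩ : ∃ k, l.card - μ.card = k + 1 := ⟨l.card - μ.card - 1, by omega⟩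
    rw [hk, UO_chain_succ]
    refine Finset.sum_congr rfl fun κ hκ => ?_
    have := (UO_mem_down.1 hκ).2
    rw [UO_skewDim_chain, show κ.card - μ.card = k by omega]
  · rw [UO_skewDim_small h, Finset.sum_eq_zero, add_zero]
    intro κ hκ
    have := (UO_mem_down.1 hκ).2
    rw [UO_skewDim_small (by omega), if_neg]
    rintro rfl; omega

theorem UO_exists_down {l : YoungDiagram} (h : 0 < l.card) : ∃ κ, Covers κ l := by
  obtain ⟨b, hb⟩ := l.cells.exists_maximal (Finset.card_pos.1 h)
  refine ⟨⟨l.cells.erase b, ?_⟩, ?_, ?_⟩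
  · intro x y hyx hx
    simp only [coe_erase, Set.mem_sdiff, mem_coe, Set.mem_singleton_iff] at hx ⊢
    refine ⟨l.isLowerSet hyx hx.1, ?_⟩
    rintro rfl
    exact hx.2 (le_antisymm (hb.2 hx.1 hyx) hyx)
  · intro x hx
    exact Finset.mem_of_mem_erase hx
  · exact (Finset.card_erase_add_one hb.1).symm

theorem UO_dim_pos (n : ℕ) : ∀ l : YoungDiagram, l.card = n → 0 < l.dim := by
  classical
  induction n with
  | zero =>
    intro l hl
    have : l = ⊥ := UO_ext (by simpa using Finset.card_eq_zero.1 hl)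
    subst this
    rw [dim, UO_skewDim_small le_rfl, if_pos rfl]; exact one_pos
  | succ n ih =>
    intro l hl
    obtain ⟨κ, hκ⟩ := UO_exists_down (l := l) (by omega)
    have h1 := ih κ (by have := hκ.2; omega)
    rw [dim, UO_skewDim_rec]
    have := Finset.single_le_sum (f := fun κ => skewDim ⊥ κ) (fun _ _ => Nat.zero_le _)
      (UO_mem_down.2 hκ)
    rw [dim] at h1
    omega

noncomputable def UO_W (z z' : ℂ) (κ l : YoungDiagram) : ℂ := poch z κ l * poch z' κ l

theorem UO_poch_single {w : ℂ} {κ l : YoungDiagram} {b : ℕ × ℕ} (hb : b ∉ κ)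
    (h : l.cells = insert b κ.cells) : poch w κ l = w + (b.2 : ℂ) - (b.1 : ℂ) := by
  rw [poch, h, Finset.insert_sdiff_of_notMem _ (by simpa using hb)]
  simp

theorem UO_covers_eq {κ l : YoungDiagram} (h : Covers κ l) :
    ∃ b, b ∉ κ ∧ l.cells = insert b κ.cells := by
  obtain ⟨h1, h2⟩ := h
  have hs : κ.cells ⊆ l.cells := h1
  have : (l.cells \ κ.cells).card = 1 := by
    rw [Finset.card_sdiff_of_subset hs]
    have : l.cells.card = κ.cells.card + 1 := h2
    omega
  obtain ⟨b, hb⟩ := Finset.card_eq_one.1 this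
  refine ⟨b, ?_, ?_⟩
  · have : b ∈ l.cells \ κ.cells := by simp [hb]
    simpa using (Finset.mem_sdiff.1 this).2
  · rw [Finset.insert_eq, ← hb, Finset.sdiff_union_of_subset hs]

/-- row statistics -/
theorem UO_sum_rows (l : YoungDiagram) (N : ℕ) (hN : l.card ≤ N) :
    ∑ i ∈ range N, l.rowLen i = l.card := by
  have : l.card = ∑ i ∈ range N, (l.cells.filter (fun b => b.1 = i)).card := by
    refine Finset.card_eq_sum_card_fiberwise ?_
    rintro ⟨i, j⟩ hb
    have := l.UO_lt_card_left hb
    simp; omega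
  rw [this]
  refine Finset.sum_congr rfl fun i _ => ?_
  rw [YoungDiagram.rowLen_eq_card]; rfl

theorem UO_rowLen_zero (l : YoungDiagram) {N : ℕ} (hN : l.card ≤ N) : l.rowLen N = 0 := by
  by_contra h
  have : (N, 0) ∈ l := by rw [mem_iff_lt_rowLen]; omega
  have := l.UO_lt_card_left this
  omega

def UO_add (l : YoungDiagram) (i : ℕ) (h : i = 0 ∨ l.rowLen i < l.rowLen (i-1)) : YoungDiagram where
  cells := insert (i, l.rowLen i) l.cells
  isLowerSet := by
    rintro ⟨a, b⟩ ⟨c, d⟩ hle hx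
    simp only [coe_insert, Set.mem_insert_iff, mem_coe, Prod.mk.injEq, mem_cells,
      mem_iff_lt_rowLen] at hx ⊢
    have h1 : c ≤ a := hle.1
    have h2 : d ≤ b := hle.2
    have h3 := l.rowLen_anti _ _ h1
    rcases hx with ⟨rfl, rfl⟩ | hx
    · rcases Nat.lt_or_ge c a with h4 | h4
      · have := l.rowLen_anti c (a-1) (by omega)
        omega
      · have : c = a := by omega
        subst this; omega
    · omega

def UO_rem (l : YoungDiagram) (i : ℕ) (h : l.rowLen (i+1) < l.rowLen i) : YoungDiagram where
  cells := l.cells.erase (i, l.rowLen i - 1)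
  isLowerSet := by
    rintro ⟨a, b⟩ ⟨c, d⟩ hle hx
    simp only [coe_erase, Set.mem_sdiff, mem_coe, Set.mem_singleton_iff, Prod.mk.injEq, mem_cells,
      mem_iff_lt_rowLen] at hx ⊢
    have h1 : c ≤ a := hle.1
    have h2 : d ≤ b := hle.2
    have h3 := l.rowLen_anti _ _ h1
    refine ⟨by omega, ?_⟩
    rintro ⟨rfl, rfl⟩
    rcases Nat.lt_or_ge c a with h4 | h4
    · have := l.rowLen_anti (c+1) a (by omega)
      omega
    · have : c = a := by omega
      subst this; omega

theorem UO_up_sum (l : YoungDiagram) (z z' : ℂ) (N : ℕ) (hN : l.card ≤ N) :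
    ∑ ν ∈ UO_up l, UO_W z z' l ν =
      ∑ i ∈ (range (N+1)).filter (fun i => i = 0 ∨ l.rowLen i < l.rowLen (i-1)),
        (z + (l.rowLen i : ℂ) - i) * (z' + (l.rowLen i : ℂ) - i) := by
  symm
  refine Finset.sum_bij (fun i hi => l.UO_add i (Finset.mem_filter.1 hi).2) ?_ ?_ ?_ ?_
  · intro i hi
    rw [UO_mem_up]
    refine ⟨Finset.subset_insert _ _, ?_⟩
    refine Finset.card_insert_of_notMem ?_
    rw [mem_cells, mem_iff_lt_rowLen]; omega
  · intro i hi j hj hij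
    have : (i, l.rowLen i) ∈ (l.UO_add j (Finset.mem_filter.1 hj).2).cells := by
      rw [← hij]; exact Finset.mem_insert_self _ _
    rcases Finset.mem_insert.1 this with h | h
    · exact (Prod.ext_iff.1 h).1
    · rw [mem_cells, mem_iff_lt_rowLen] at h; omega
  · intro ν hν
    rw [UO_mem_up] at hν
    obtain ⟨⟨i, j⟩, hb, hc⟩ := UO_covers_eq hν
    have hin : (i, j) ∈ ν := by rw [← mem_cells, hc]; exact Finset.mem_insert_self _ _
    have hmem : ∀ c d, (c, d) ∈ ν → (c, d) ≠ (i, j) → d < l.rowLen c := by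
      intro c d h1 h2
      rw [← mem_cells, hc] at h1
      rw [← mem_iff_lt_rowLen]
      simpa using Finset.mem_of_mem_insert_of_ne h1 h2
    rw [mem_iff_lt_rowLen] at hb
    have hj : j = l.rowLen i := by
      by_contra hne
      have := hmem i (l.rowLen i) (ν.up_left_mem le_rfl (by omega) hin) (by
        intro h; have := (Prod.ext_iff.1 h).2; simp at this; omega)
      omega
    subst hj
    have hcond : i = 0 ∨ l.rowLen i < l.rowLen (i-1) := by
      by_cases hi : i = 0
      · exact Or.inl hi
      · right
        exact hmem (i-1) (l.rowLen i) (ν.up_left_mem (by omega) le_rfl hin) (by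
          intro h; have := (Prod.ext_iff.1 h).1; simp at this; omega)
    refine ⟨i, ?_, ?_⟩
    · simp only [Finset.mem_filter, Finset.mem_range]
      refine ⟨?_, hcond⟩
      have := ν.UO_lt_card_left hin
      have := hν.2
      omega
    · exact UO_ext hc.symm
  · intro i hi
    have hb : (i, l.rowLen i) ∉ l := by rw [mem_iff_lt_rowLen]; omega
    rw [UO_W, UO_poch_single hb rfl, UO_poch_single hb rfl]

theorem UO_down_sum (l : YoungDiagram) (z z' : ℂ) (N : ℕ) (hN : l.card ≤ N) :
    ∑ κ ∈ UO_down l, UO_W z z' κ l =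
      ∑ i ∈ (range N).filter (fun i => l.rowLen (i+1) < l.rowLen i),
        (z + (l.rowLen i : ℂ) - 1 - i) * (z' + (l.rowLen i : ℂ) - 1 - i) := by
  symm
  refine Finset.sum_bij (fun i hi => l.UO_rem i (Finset.mem_filter.1 hi).2) ?_ ?_ ?_ ?_
  · intro i hi
    have hlt := (Finset.mem_filter.1 hi).2
    rw [UO_mem_down]
    refine ⟨Finset.erase_subset _ _, ?_⟩
    refine (Finset.card_erase_add_one ?_).symm
    rw [mem_cells, mem_iff_lt_rowLen]; omega
  · intro i hi j hj hij
    have hlt := (Finset.mem_filter.1 hi).2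
    have h0 : (i, l.rowLen i - 1) ∉ (l.UO_rem j (Finset.mem_filter.1 hj).2).cells := by
      rw [← hij]; exact Finset.notMem_erase _ _
    by_contra hne
    apply h0
    refine Finset.mem_erase.2 ⟨fun h => hne (Prod.ext_iff.1 h).1, ?_⟩
    rw [mem_cells, mem_iff_lt_rowLen]; omega
  · intro κ hκ
    rw [UO_mem_down] at hκ
    obtain ⟨⟨i, j⟩, hb, hc⟩ := UO_covers_eq hκ
    have hin : (i, j) ∈ l := by rw [← mem_cells, hc]; exact Finset.mem_insert_self _ _
    have hmem : ∀ c d, (c, d) ∈ l → (c, d) ≠ (i, j) → (c, d) ∈ κ := by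
      intro c d h1 h2
      rw [← mem_cells, hc] at h1
      simpa using Finset.mem_of_mem_insert_of_ne h1 h2
    have hin' := mem_iff_lt_rowLen.1 hin
    have hj : j = l.rowLen i - 1 := by
      by_contra hne
      exact hb (κ.up_left_mem le_rfl (Nat.le_succ j) (hmem i (j+1) (by
        rw [mem_iff_lt_rowLen]; omega) (by simp)))
    have hcond : l.rowLen (i+1) < l.rowLen i := by
      by_contra hge
      exact hb (κ.up_left_mem (Nat.le_succ i) le_rfl (hmem (i+1) j (by
        rw [mem_iff_lt_rowLen]; omega) (by simp)))
    subst hj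
    refine ⟨i, ?_, ?_⟩
    · simp only [Finset.mem_filter, Finset.mem_range]
      refine ⟨?_, hcond⟩
      have := l.UO_lt_card_left hin
      omega
    · refine UO_ext ?_
      change l.cells.erase _ = _
      rw [hc, Finset.erase_insert (by simpa using hb)]
  · intro i hi
    have hlt := (Finset.mem_filter.1 hi).2
    have hin : (i, l.rowLen i - 1) ∈ l.cells := by
      rw [mem_cells, mem_iff_lt_rowLen]; omega
    have hb : (i, l.rowLen i - 1) ∉ l.UO_rem i hlt := by
      rw [← mem_cells]; exact Finset.notMem_erase _ _
    have hc : l.cells = insert (i, l.rowLen i - 1) (l.UO_rem i hlt).cells :=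
      (Finset.insert_erase hin).symm
    rw [UO_W, UO_poch_single hb hc, UO_poch_single hb hc]
    have : ((l.rowLen i - 1 : ℕ) : ℂ) = (l.rowLen i : ℂ) - 1 := by
      rw [Nat.cast_sub (by omega)]; simp
    simp only [this]
    ring

theorem UO_tele (r : ℕ → ℂ) (z z' : ℂ) (N : ℕ) :
    (z + r 0) * (z' + r 0) +
    ∑ i ∈ range N, ((z + r (i+1) - (i + 1)) * (z' + r (i+1) - (i + 1)) -
      (z + r i - 1 - i) * (z' + r i - 1 - i))
      = 2 * (∑ i ∈ range N, r i) + (z * z' + (z + r N - N) * (z' + r N - N) - (z-N) * (z'-N)) := by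
  induction N with
  | zero => simp
  | succ N ih =>
    rw [Finset.sum_range_succ, ← add_assoc, ih, Finset.sum_range_succ]
    push_cast
    ring

theorem UO_diag (l : YoungDiagram) (z z' : ℂ) :
    ∑ ν ∈ UO_up l, UO_W z z' l ν =
      ∑ κ ∈ UO_down l, UO_W z z' κ l + (z * z' + 2 * (l.card : ℂ)) := by
  rw [UO_up_sum l z z' l.card le_rfl, UO_down_sum l z z' l.card le_rfl, Finset.sum_filter,
    Finset.sum_filter, Finset.sum_range_succ', ← sub_eq_iff_eq_add']
  have h := UO_tele (fun i => (l.rowLen i : ℂ)) z z' l.card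
  have h2 : ∑ i ∈ range l.card, (l.rowLen i : ℂ) = l.card := by
    rw [← Nat.cast_sum, UO_sum_rows l _ le_rfl]
  simp only [h2, UO_rowLen_zero l le_rfl] at h
  rw [add_sub_right_comm, ← Finset.sum_sub_distrib]
  have h3 : ∀ i ∈ range l.card,
      ((if i + 1 = 0 ∨ l.rowLen (i+1) < l.rowLen (i + 1 - 1) then
          (z + (l.rowLen (i+1) : ℂ) - ((i+1 : ℕ) : ℂ)) * (z' + (l.rowLen (i+1) : ℂ) - ((i+1 : ℕ) : ℂ))
        else 0) -
        (if l.rowLen (i+1) < l.rowLen i then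
          (z + (l.rowLen i : ℂ) - 1 - i) * (z' + (l.rowLen i : ℂ) - 1 - i) else 0)) =
      ((z + (l.rowLen (i+1) : ℂ) - (i + 1)) * (z' + (l.rowLen (i+1) : ℂ) - (i + 1)) -
      (z + (l.rowLen i : ℂ) - 1 - i) * (z' + (l.rowLen i : ℂ) - 1 - i)) := by
    intro i _
    by_cases hlt : l.rowLen (i+1) < l.rowLen i
    · simp [hlt]
    · have : l.rowLen (i+1) = l.rowLen i :=
        le_antisymm (l.rowLen_anti _ _ (Nat.le_succ i)) (by omega)
      simp [this]
      ring
  rw [Finset.sum_congr rfl h3]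
  simp only [true_or, if_true, Nat.cast_zero, sub_zero]
  push_cast at h
  linear_combination h

open Classical in
theorem UO_comm (l κ : YoungDiagram) (hc : κ.card = l.card) (z z' : ℂ) :
    ∑ ν ∈ UO_up l ∩ UO_up κ, UO_W z z' l ν =
      ∑ ρ ∈ UO_down l ∩ UO_down κ, UO_W z z' ρ κ +
        if κ = l then (z * z' + 2 * (l.card : ℂ)) else 0 := by
  split_ifs with h
  · subst h
    simpa using UO_diag κ z z'
  · rw [add_zero]
    have hcard : (l ⊔ κ).card + (l ⊓ κ).card = l.card + κ.card :=
      Finset.card_union_add_card_inter l.cells κ.cells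
    have hlt : l.card < (l ⊔ κ).card := by
      refine Finset.card_lt_card ?_
      rw [Finset.ssubset_iff_subset_ne]
      refine ⟨Finset.subset_union_left, fun he => h ?_⟩
      refine UO_ext (Finset.eq_of_subset_of_card_le ?_ (le_of_eq hc.symm))
      rw [he]; exact Finset.subset_union_right
    by_cases hs : (l ⊔ κ).card = l.card + 1
    · have e1 : UO_up l ∩ UO_up κ = {l ⊔ κ} := by
        ext ν
        simp only [Finset.mem_inter, UO_mem_up, Finset.mem_singleton]
        constructor
        · rintro ⟨h1, h2⟩
          have h3 : l ⊔ κ ≤ ν := sup_le h1.1 h2.1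
          refine (UO_ext (Finset.eq_of_subset_of_card_le h3 ?_)).symm
          exact le_of_eq (h1.2.trans hs.symm)
        · rintro rfl
          exact ⟨⟨le_sup_left, hs⟩, ⟨le_sup_right, by omega⟩⟩
      have e2 : UO_down l ∩ UO_down κ = {l ⊓ κ} := by
        ext ν
        simp only [Finset.mem_inter, UO_mem_down, Finset.mem_singleton]
        constructor
        · rintro ⟨h1, h2⟩
          have h3 : ν ≤ l ⊓ κ := le_inf h1.1 h2.1
          refine UO_ext (Finset.eq_of_subset_of_card_le h3 ?_)
          have := h1.2
          change (l ⊓ κ).card ≤ ν.card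
          omega
        · rintro rfl
          exact ⟨⟨inf_le_left, by omega⟩, ⟨inf_le_right, by omega⟩⟩
      rw [e1, e2, Finset.sum_singleton, Finset.sum_singleton]
      have : (l ⊔ κ).cells \ l.cells = κ.cells \ (l ⊓ κ).cells := by
        ext b; simp; tauto
      simp only [UO_W, poch, this]
    · have e1 : UO_up l ∩ UO_up κ = ∅ := by
        refine Finset.eq_empty_of_forall_notMem fun ν hν => hs ?_
        simp only [Finset.mem_inter, UO_mem_up] at hν
        have h3 : l ⊔ κ ≤ ν := sup_le hν.1.1 hν.2.1
        have h4 : (l ⊔ κ).card ≤ ν.card := Finset.card_le_card h3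
        have := hν.1.2
        omega
      have e2 : UO_down l ∩ UO_down κ = ∅ := by
        refine Finset.eq_empty_of_forall_notMem fun ν hν => hs ?_
        simp only [Finset.mem_inter, UO_mem_down] at hν
        have h3 : ν ≤ l ⊓ κ := le_inf hν.1.1 hν.2.1
        have h4 : ν.card ≤ (l ⊓ κ).card := Finset.card_le_card h3
        have := hν.1.2
        omega
      rw [e1, e2, Finset.sum_empty, Finset.sum_empty]

theorem UO_main (z z' : ℂ) (μ : YoungDiagram) (n : ℕ) : ∀ l : YoungDiagram, l.card = n →
    ∑ ν ∈ UO_up l, UO_W z z' l ν * (skewDim μ ν : ℂ) =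
      ∑ κ ∈ UO_down μ, UO_W z z' κ μ * (skewDim κ l : ℂ) +
        ((n : ℂ) - μ.card + 1) * (n + z * z' + μ.card) * (skewDim μ l : ℂ) := by
  classical
  induction n using Nat.strong_induction_on with
  | _ n ih =>
  intro l hl
  have hrec : ∀ a b : YoungDiagram, (skewDim a b : ℂ) =
      (if a = b then 1 else 0) + ∑ κ ∈ UO_down b, (skewDim a κ : ℂ) := by
    intro a b
    rw [UO_skewDim_rec a b]; push_cast; rfl
  have s1 : ∑ ν ∈ UO_up l, UO_W z z' l ν * (skewDim μ ν : ℂ) =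
      (if Covers l μ then UO_W z z' l μ else 0) +
      ∑ ν ∈ UO_up l, ∑ κ ∈ UO_down ν, UO_W z z' l ν * (skewDim μ κ : ℂ) := by
    have e : (if Covers l μ then UO_W z z' l μ else 0) =
        ∑ ν ∈ UO_up l, if μ = ν then UO_W z z' l ν else 0 := by
      rw [Finset.sum_ite_eq]; simp only [UO_mem_up]
    rw [e, ← Finset.sum_add_distrib]
    refine Finset.sum_congr rfl fun ν _ => ?_
    rw [hrec μ ν, mul_add, Finset.mul_sum]
    simp
  have s2 : ∑ ν ∈ UO_up l, ∑ κ ∈ UO_down ν, UO_W z z' l ν * (skewDim μ κ : ℂ) =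
      ∑ κ ∈ UO_Y n, ∑ ν ∈ UO_up l ∩ UO_up κ, UO_W z z' l ν * (skewDim μ κ : ℂ) := by
    refine Finset.sum_comm' ?_
    intro ν κ
    simp only [Finset.mem_inter, UO_mem_up, UO_mem_down, UO_mem_Y]
    constructor
    · rintro ⟨h1, h2⟩
      have := h1.2; have := h2.2
      exact ⟨⟨h1, h2⟩, by omega⟩
    · rintro ⟨h1, _⟩; exact h1
  have s3 : ∑ κ ∈ UO_Y n, ∑ ν ∈ UO_up l ∩ UO_up κ, UO_W z z' l ν * (skewDim μ κ : ℂ) =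
      (∑ κ ∈ UO_Y n, ∑ ρ ∈ UO_down l ∩ UO_down κ, UO_W z z' ρ κ * (skewDim μ κ : ℂ)) +
      (z * z' + 2 * (n : ℂ)) * (skewDim μ l : ℂ) := by
    have : (z * z' + 2 * (n : ℂ)) * (skewDim μ l : ℂ) =
        ∑ κ ∈ UO_Y n, if κ = l then (z * z' + 2 * (n : ℂ)) * (skewDim μ κ : ℂ) else 0 := by
      rw [Finset.sum_ite_eq', if_pos (UO_mem_Y.2 hl)]
    rw [this, ← Finset.sum_add_distrib]
    refine Finset.sum_congr rfl fun κ hκ => ?_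
    rw [← Finset.sum_mul, UO_comm l κ ((UO_mem_Y.1 hκ).trans hl.symm), add_mul, Finset.sum_mul, hl]
    split_ifs <;> simp
  have s4 : ∑ κ ∈ UO_Y n, ∑ ρ ∈ UO_down l ∩ UO_down κ, UO_W z z' ρ κ * (skewDim μ κ : ℂ) =
      ∑ ρ ∈ UO_down l, ∑ κ ∈ UO_up ρ, UO_W z z' ρ κ * (skewDim μ κ : ℂ) := by
    refine Finset.sum_comm' ?_
    intro κ ρ
    simp only [Finset.mem_inter, UO_mem_up, UO_mem_down, UO_mem_Y]
    constructor
    · rintro ⟨_, h1, h2⟩; exact ⟨h2, h1⟩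
    · rintro ⟨h2, h1⟩
      have := h1.2; have := h2.2
      exact ⟨by omega, h1, h2⟩
  have s5 : ∑ ρ ∈ UO_down l, ∑ κ ∈ UO_up ρ, UO_W z z' ρ κ * (skewDim μ κ : ℂ) =
      ∑ ρ ∈ UO_down l, (∑ κ ∈ UO_down μ, UO_W z z' κ μ * (skewDim κ ρ : ℂ) +
        ((n : ℂ) - μ.card) * (n - 1 + z * z' + μ.card) * (skewDim μ ρ : ℂ)) := by
    refine Finset.sum_congr rfl fun ρ hρ => ?_
    have h := (UO_mem_down.1 hρ).2
    rw [ih ρ.card (by omega) ρ rfl]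
    have : (n : ℂ) = ρ.card + 1 := by rw [← hl, h]; push_cast; rfl
    rw [this]
    ring
  have s6 : ∑ ρ ∈ UO_down l, ∑ κ ∈ UO_down μ, UO_W z z' κ μ * (skewDim κ ρ : ℂ) =
      ∑ κ ∈ UO_down μ, UO_W z z' κ μ * (skewDim κ l : ℂ)
        - (if Covers l μ then UO_W z z' l μ else 0) := by
    have e : (if Covers l μ then UO_W z z' l μ else 0) =
        ∑ κ ∈ UO_down μ, if κ = l then UO_W z z' κ μ else 0 := by
      rw [Finset.sum_ite_eq']; simp only [UO_mem_down]
    rw [Finset.sum_comm, eq_sub_iff_add_eq, e, ← Finset.sum_add_distrib]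
    refine Finset.sum_congr rfl fun κ _ => ?_
    rw [hrec κ l, mul_add, Finset.mul_sum]
    simp [add_comm]
  have s7 : ((n : ℂ) - μ.card) * ∑ ρ ∈ UO_down l, (skewDim μ ρ : ℂ) =
      ((n : ℂ) - μ.card) * (skewDim μ l : ℂ) := by
    rw [hrec μ l]
    split_ifs with h
    · subst h; rw [hl]; simp
    · simp
  rw [s1, s2, s3, s4, s5, Finset.sum_add_distrib, s6, ← Finset.mul_sum]
  linear_combination ((n : ℂ) - 1 + z * z' + μ.card) * s7

theorem UO_desc (n : ℂ) (m : ℕ) :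
    (∏ i ∈ range m, (n + 1 - (i : ℂ))) * (n - m + 1) = (n + 1) * ∏ i ∈ range m, (n - (i : ℂ)) := by
  induction m with
  | zero => simp
  | succ m ih =>
    rw [Finset.prod_range_succ, Finset.prod_range_succ]
    push_cast
    linear_combination (n - m) * ih

theorem UO_desc' (n : ℂ) (m : ℕ) :
    (∏ i ∈ range (m+1), (n + 1 - (i : ℂ))) = (n + 1) * ∏ i ∈ range m, (n - (i : ℂ)) := by
  rw [Finset.prod_range_succ', mul_comm]
  congr 1
  · simp
  · refine Finset.prod_congr rfl fun i _ => ?_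
    push_cast; ring

end YoungDiagram

open YoungDiagram in
/-- The "up" operator of the z-measures acts on the Frobenius–Schur
functions by: for `|μ| = m` and `|λ| = n`,
`∑_{ν ↘ λ} (z)_{ν/λ}(z')_{ν/λ} (dim ν / ((n+1) dim λ)) FS_μ(ν)
  = ∑_{μ• ↗ μ} (z)_{μ/μ•}(z')_{μ/μ•} FS_{μ•}(λ) + (n + zz' + m) FS_μ(λ)`. -/
theorem up_operator_on_FS (z z' : ℂ) (μ l : YoungDiagram) (m n : ℕ)
    (hm : μ.card = m) (hn : l.card = n) :
    ∑ᶠ (ν : YoungDiagram) (_ : Covers l ν),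
        poch z l ν * poch z' l ν * ((ν.dim : ℂ) / (((n : ℂ) + 1) * (l.dim : ℂ))) * μ.FS ν
      = (∑ᶠ (κ : YoungDiagram) (_ : Covers κ μ),
            poch z κ μ * poch z' κ μ * κ.FS l)
        + ((n : ℂ) + z * z' + (m : ℂ)) * μ.FS l := by
  simp only [← UO_mem_up (l := l), ← UO_mem_down (l := μ)]
  rw [finsum_mem_finset_eq_sum, finsum_mem_finset_eq_sum]
  have hd : ∀ a : YoungDiagram, (a.dim : ℂ) ≠ 0 := fun a =>
    Nat.cast_ne_zero.2 (UO_dim_pos _ a rfl).ne'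
  have hn1 : (n : ℂ) + 1 ≠ 0 := Nat.cast_add_one_ne_zero n
  have main := UO_main z z' μ n l hn
  rw [hm] at main
  have dl := hd l
  -- the common factor
  have hP := UO_desc (n : ℂ) m
  set P : ℂ := ∏ i ∈ Finset.range m, ((n : ℂ) + 1 - (i : ℂ)) with hPdef
  have t1 : ∑ ν ∈ UO_up l, poch z l ν * poch z' l ν *
      ((ν.dim : ℂ) / (((n : ℂ) + 1) * (l.dim : ℂ))) * μ.FS ν =
      P / ((n + 1) * l.dim) * ∑ ν ∈ UO_up l, UO_W z z' l ν * (skewDim μ ν : ℂ) := by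
    rw [Finset.mul_sum]
    refine Finset.sum_congr rfl fun ν hν => ?_
    have hc : (ν.card : ℂ) = n + 1 := by
      rw [(UO_mem_up.1 hν).2, hn]; push_cast; rfl
    have dν := hd ν
    rw [FS, hm, hc, ← hPdef, UO_W]
    field_simp
  have t2 : ∑ κ ∈ UO_down μ, poch z κ μ * poch z' κ μ * κ.FS l =
      P / ((n + 1) * l.dim) * ∑ κ ∈ UO_down μ, UO_W z z' κ μ * (skewDim κ l : ℂ) := by
    rw [Finset.mul_sum]
    refine Finset.sum_congr rfl fun κ hκ => ?_
    have hc : m = κ.card + 1 := by rw [← hm]; exact (UO_mem_down.1 hκ).2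
    rw [hPdef, FS, hn, hc, UO_desc', UO_W]
    field_simp
  rw [t1, t2, main, FS, hm, hn, mul_add]
  congr 1
  field_simp
  linear_combination (n + z * z' + m) * (skewDim μ l : ℂ) * hP
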